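/- arXiv:2407.17811 — 3 statements merged into one kernel-verified Lean document; each statement's English description precedes it below -/
import Mathlib

section
/- Let I ⊆ J be Cox-Gorenstein ideals of S of socle degrees ω′ and ω respectively, with associated functionals Λ′ : S_{ω′} → K and Λ : S_ω → K. Then there exists a homogeneous element F ∈ S_{ω′−ω} such that Λ(Q) = Λ′(QF) for all Q ∈ S_ω. -/
/- STATEMENT 15: Let I ⊆ J be Cox-Gorenstein ideals of S of socle degrees ω′
and ω, with associated functionals Λ′ : S_{ω′} → K and Λ : S_ω → K.  Then there
exists a homogeneous F ∈ S_{ω′−ω} with Λ(Q) = Λ′(QF) for all Q ∈ S_ω. -/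

set_option linter.unusedSectionVars false
set_option synthInstance.maxHeartbeats 1000000
set_option maxHeartbeats 1000000

noncomputable section

variable {G : Type*} [AddCommGroup G] [PartialOrder G]
  [CovariantClass G G (· + ·) (· ≤ ·)] [DecidableEq G]
variable {K : Type*} [Field K] [CharZero K]
variable {S : Type*} [CommRing S] [Algebra K S]

/-- `Λ : S_ω → K` is the functional associated with the ideal `I`:
`I_g = {P ∈ S_g : Λ(PQ) = 0 for all Q ∈ S_{ω−g}}` for every `g`. -/
def IsAssociatedFunctional (𝒜 : G → Submodule K S) [GradedAlgebra 𝒜]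
    (I : Ideal S) (ω : G) (Λ : (𝒜 ω) →ₗ[K] K) : Prop :=
  ∀ g : G, ∀ P : S, ∀ hP : P ∈ 𝒜 g,
    (P ∈ I ↔ ∀ Q : S, ∀ hQ : Q ∈ 𝒜 (ω - g),
      Λ ⟨P * Q, by
        have := SetLike.mul_mem_graded hP hQ
        rwa [show g + (ω - g) = ω by abel] at this⟩ = 0)

/-- The pairing `(F, Q) ↦ Λ (Q * F)` of graded pieces whose degrees add up to that of `Λ`. -/
def gradedPairing (𝒜 : G → Submodule K S) [GradedAlgebra 𝒜] {a b c : G} (h : b + a = c)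
    (Λ : (𝒜 c) →ₗ[K] K) : (𝒜 a) →ₗ[K] Module.Dual K (𝒜 b) :=
  LinearMap.mk₂ K
    (fun F Q => Λ ⟨(Q : S) * F, h ▸ SetLike.mul_mem_graded Q.2 F.2⟩)
    (fun F F' Q => by rw [← map_add]; congr 1; ext; simp [mul_add])
    (fun r F Q => by rw [← map_smul]; congr 1; ext; simp)
    (fun F Q Q' => by rw [← map_add]; congr 1; ext; simp [add_mul])
    (fun r F Q => by rw [← map_smul]; congr 1; ext; simp)

theorem exists_homogeneous_factor_of_cox_gorenstein_inclusion
    (𝒜 : G → Submodule K S) [GradedAlgebra 𝒜]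
    (h0 : 𝒜 0 = Submodule.span K {(1 : S)})
    (hfd : ∀ g : G, FiniteDimensional K (𝒜 g))
    (I J : Ideal S) (hIJ : I ≤ J) (ω' ω : G)
    (hArtI : IsArtinianRing (S ⧸ I)) (hArtJ : IsArtinianRing (S ⧸ J))
    (Λ' : (𝒜 ω') →ₗ[K] K) (hΛ' : IsAssociatedFunctional 𝒜 I ω' Λ')
    (Λ : (𝒜 ω) →ₗ[K] K) (hΛ : IsAssociatedFunctional 𝒜 J ω Λ) :
    ∃ F : S, ∃ hF : F ∈ 𝒜 (ω' - ω), ∀ Q : S, ∀ hQ : Q ∈ 𝒜 ω,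
      Λ ⟨Q, hQ⟩ = Λ' ⟨Q * F, by
        have := SetLike.mul_mem_graded hQ hF
        rwa [show ω + (ω' - ω) = ω' by abel] at this⟩ := by
  have hω : ω + (ω' - ω) = ω' := by abel
  let B := gradedPairing 𝒜 hω Λ'
  have hmem : Λ ∈ LinearMap.range B := by
    have := hfd ω
    rw [← Subspace.dualCoannihilator_dualAnnihilator_eq (W := LinearMap.range B),
      Submodule.mem_dualAnnihilator]
    intro Q hQ
    rw [Submodule.mem_dualCoannihilator] at hQ
    have hQI : (Q : S) ∈ I :=
      (hΛ' ω Q Q.2).2 fun F hF => hQ (B ⟨F, hF⟩) (LinearMap.mem_range_self B _)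
    have h1 : (1 : S) ∈ 𝒜 (ω - ω) := by
      rw [sub_self]
      exact SetLike.one_mem_graded 𝒜
    simpa using (hΛ ω Q Q.2).1 (hIJ hQI) 1 h1
  obtain ⟨F, hF⟩ := hmem
  exact ⟨F, F.2, fun Q hQ => (LinearMap.congr_fun hF ⟨Q, hQ⟩).symm⟩

end
end

section
/- Let I′ be a Cox-Gorenstein ideal of S of socle degree ω′, and let F ∈ S_{ω′−ω} be a homogeneous element with F ∉ I′. Then the colon ideal I = (I′ : F) = {P ∈ S : PF ∈ I′} is a Cox-Gorenstein ideal of socle degree ω, with associated functional Λ given by Λ(Q) = Λ′(QF) for Q ∈ S_ω, where Λ′ is the functional associated with I′. -/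
/- STATEMENT 16: Let I′ be a Cox-Gorenstein ideal of S of socle degree ω′ with
associated functional Λ′, and let F ∈ S_{ω′−ω} be homogeneous with F ∉ I′.
Then I = (I′ : F) is a Cox-Gorenstein ideal of socle degree ω, with associated
functional Λ given by Λ(Q) = Λ′(QF) for Q ∈ S_ω. -/

set_option linter.unusedSectionVars false
set_option synthInstance.maxHeartbeats 1000000
set_option maxHeartbeats 1000000

noncomputable section

variable {G : Type*} [AddCommGroup G] [PartialOrder G]
  [CovariantClass G G (· + ·) (· ≤ ·)] [DecidableEq G]
variable {K : Type*} [Field K] [CharZero K]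
variable {S : Type*} [CommRing S] [Algebra K S]

/-- A Cox-Gorenstein ideal of socle degree `ω`: a homogeneous ideal with
Artinian quotient, cut out by a linear functional on `S_ω`. -/
def IsCoxGorensteinIdeal (𝒜 : G → Submodule K S) [GradedAlgebra 𝒜]
    (I : Ideal S) (ω : G) : Prop :=
  IsArtinianRing (S ⧸ I) ∧ ∃ Λ : (𝒜 ω) →ₗ[K] K, IsAssociatedFunctional 𝒜 I ω Λ

/-- Multiplication by a homogeneous element `F`, as a map between graded pieces. -/
def gradedMulRight (𝒜 : G → Submodule K S) [GradedAlgebra 𝒜] {ω ω' : G} {F : S}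
    (hF : F ∈ 𝒜 (ω' - ω)) : 𝒜 ω →ₗ[K] 𝒜 ω' :=
  (LinearMap.mulRight K F).restrict fun Q hQ => by
    have h := SetLike.mul_mem_graded hQ hF
    rwa [add_sub_cancel] at h

theorem isAssociatedFunctional_colon (𝒜 : G → Submodule K S) [GradedAlgebra 𝒜]
    {I : Ideal S} {ω ω' : G} {Λ : 𝒜 ω' →ₗ[K] K} (hΛ : IsAssociatedFunctional 𝒜 I ω' Λ)
    {F : S} (hF : F ∈ 𝒜 (ω' - ω)) :
    IsAssociatedFunctional 𝒜 (I.colon (Ideal.span {F})) ω (Λ ∘ₗ gradedMulRight 𝒜 hF) := by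
  intro g P hP
  have hdeg : ω' - (g + (ω' - ω)) = ω - g := by abel
  have hcolon : P ∈ I.colon (Ideal.span {F}) ↔ P * F ∈ I := by
    simp
  rw [hcolon, hΛ _ _ (SetLike.mul_mem_graded hP hF)]
  have hmul (Q : S) : P * F * Q = P * Q * F := mul_right_comm P F Q
  simp only [hdeg, hmul]
  rfl

theorem colon_cox_gorenstein
    (𝒜 : G → Submodule K S) [GradedAlgebra 𝒜]
    (h0 : 𝒜 0 = Submodule.span K {(1 : S)})
    (hfd : ∀ g : G, FiniteDimensional K (𝒜 g))
    (I' : Ideal S) (ω' ω : G)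
    (hArt : IsArtinianRing (S ⧸ I'))
    (Λ' : (𝒜 ω') →ₗ[K] K) (hΛ' : IsAssociatedFunctional 𝒜 I' ω' Λ')
    (F : S) (hF : F ∈ 𝒜 (ω' - ω)) (hF0 : F ∉ I') :
    IsCoxGorensteinIdeal 𝒜 (I'.colon (Ideal.span {F})) ω ∧
      ∃ Λ : (𝒜 ω) →ₗ[K] K,
        IsAssociatedFunctional 𝒜 (I'.colon (Ideal.span {F})) ω Λ ∧
        ∀ Q : S, ∀ hQ : Q ∈ 𝒜 ω,
          Λ ⟨Q, hQ⟩ = Λ' ⟨Q * F, by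
            have := SetLike.mul_mem_graded hQ hF
            rwa [show ω + (ω' - ω) = ω' by abel] at this⟩ := by
  have hΛ := isAssociatedFunctional_colon 𝒜 hΛ' hF
  have hle : I' ≤ I'.colon (Ideal.span {F}) := fun P hP => by
    simpa using I'.mul_mem_right F hP
  exact ⟨⟨(Ideal.Quotient.factor_surjective hle).isArtinianRing, _, hΛ⟩, _, hΛ, fun _ _ => rfl⟩

end
end

section
/- Let Q = K[X_1,…,X_n] be positively G-graded with Q_0 = K (the constant monomial is the only monomial of degree 0), and let α_1,…,α_n ∈ Q be G-homogeneous elements forming a regular sequence of maximal length n. Then A = Q/(α_1,…,α_n) is an Artinian Cox-Gorenstein G-graded K-algebra; i.e. its socle soc(A) = (0 :_A m) equals A_ω and is one-dimensional over K for some ω ∈ G. -/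
/- STATEMENT 17: Let Q = K[X₁,…,Xₙ] be positively G-graded with Q_0 = K, and let
α₁,…,αₙ be G-homogeneous elements forming a regular sequence of maximal length n.
Then A = Q/(α₁,…,αₙ) is an Artinian Cox-Gorenstein G-graded K-algebra: its socle
soc(A) = (0 :_A m) equals A_ω and is one-dimensional for some ω ∈ G. -/

open MvPolynomial

set_option linter.unusedSectionVars false
set_option synthInstance.maxHeartbeats 1000000
set_option maxHeartbeats 1000000

noncomputable section

variable {G : Type*} [AddCommGroup G] [PartialOrder G]
  [CovariantClass G G (· + ·) (· ≤ ·)] [DecidableEq G]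
variable {K : Type*} [Field K] [CharZero K]
variable {n : ℕ}

instance wga (w : Fin n → G) : GradedAlgebra (weightedHomogeneousSubmodule K w) :=
  weightedGradedAlgebra K w

/-- The degree-`g` graded piece of the quotient `Q/I`. -/
def qpiece (w : Fin n → G) (I : Ideal (MvPolynomial (Fin n) K)) (g : G) :
    Submodule K (MvPolynomial (Fin n) K ⧸ I) :=
  (weightedHomogeneousSubmodule K w g).map (Ideal.Quotient.mkₐ K I).toLinearMap

/-- The ideal `m` generated by the classes of the variables. -/
def varIdeal (I : Ideal (MvPolynomial (Fin n) K)) : Ideal (MvPolynomial (Fin n) K ⧸ I) :=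
  Ideal.span (Set.range fun i => Ideal.Quotient.mk I (X i))

/-- The socle `(0 :_A m)` of the quotient algebra. -/
def socle (I : Ideal (MvPolynomial (Fin n) K)) : Ideal (MvPolynomial (Fin n) K ⧸ I) :=
  (⊥ : Ideal (MvPolynomial (Fin n) K ⧸ I)).colon (varIdeal I)

section RegularSequence

open RingTheory.Sequence CategoryTheory Abelian

universe u v

variable {R : Type u} [CommRing R]

theorem supportDim_quotient_add_length_le_of_isWeaklyRegular
    [IsNoetherianRing R] (rs : List R) (M : Type v) [AddCommGroup M] [Module R M]
    [Module.Finite R M] (h : IsWeaklyRegular M rs) :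
    Module.supportDim R (M ⧸ (Ideal.ofList rs • ⊤ : Submodule R M)) + rs.length
      ≤ Module.supportDim R M := by
  induction rs generalizing M with
  | nil =>
    simpa using Module.supportDim_le_of_surjective _ (Submodule.mkQ_surjective _)
  | cons r rs ih =>
    rw [isWeaklyRegular_cons_iff] at h
    rw [Module.supportDim_eq_of_equiv
      (Submodule.quotOfListConsSMulTopEquivQuotSMulTopInner M r rs)]
    have h2 := Module.supportDim_quotSMulTop_succ_le_of_notMem_minimalPrimes
      (R := R) (M := M) (x := r) fun _ ↦ h.1.notMem_of_mem_minimalPrimes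
    refine le_trans ?_ h2
    rw [List.length_cons, Nat.cast_add, Nat.cast_one, ← add_assoc]
    gcongr
    exact ih _ h.2

theorem ringKrullDim_quotient_add_length_le_of_isWeaklyRegular [IsNoetherianRing R] (rs : List R)
    (h : IsWeaklyRegular R rs) :
    ringKrullDim (R ⧸ Ideal.ofList rs) + rs.length ≤ ringKrullDim R := by
  have h2 := supportDim_quotient_add_length_le_of_isWeaklyRegular rs R h
  rwa [Module.supportDim_self_eq_ringKrullDim, smul_eq_mul, Ideal.mul_top,
    Module.supportDim_quotient_eq_ringKrullDim] at h2

theorem subsingleton_ext_and_ext_equiv_hom_of_isWeaklyRegular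
    (N : ModuleCat.{u} R) (rs : List R) (hrs : ∀ r ∈ rs, r ∈ Module.annihilator R N)
    (M : ModuleCat.{u} R) (h : IsWeaklyRegular M rs) :
    (∀ i < rs.length, Subsingleton (Ext N M i)) ∧
      Nonempty (Ext N M rs.length ≃ₗ[R] (N →ₗ[R] M ⧸ (Ideal.ofList rs • ⊤ : Submodule R M))) := by
  induction rs generalizing M with
  | nil =>
    refine ⟨by simp, ⟨?_⟩⟩
    exact (Ext.linearEquiv₀ (R := R)).trans (ModuleCat.homLinearEquiv.trans
      (Submodule.quotEquivOfEqBot _ (by simp)).symm.congrRight)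
  | cons r rs ih =>
    rw [isWeaklyRegular_cons_iff] at h
    obtain ⟨hvan, ⟨e⟩⟩ := ih (fun s hs ↦ hrs s (by simp [hs]))
      (ModuleCat.of R (QuotSMulTop r M)) h.2
    have hS := h.1.smulShortComplex_shortExact (M := M)
    have hzero (i : ℕ) (x : Ext N M i) :
        x.comp (Ext.mk₀ (ModuleCat.smulShortComplex M r).f) (add_zero i) = 0 := by
      have hr := Ext.postcomp_smul_id_eq_zero_of_mem_annihilator (N := N) (M := M)
        (hrs r (by simp)) i
      exact ConcreteCategory.congr_hom hr x
    have hvan' (i : ℕ) (hi : i < rs.length + 1) : Subsingleton (Ext N M i) := by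
      refine subsingleton_of_forall_eq 0 fun x ↦ ?_
      cases i with
      | zero =>
        exact Ext.postcomp_mk₀_injective_of_mono N (ModuleCat.smulShortComplex M r).f
          (hf := hS.mono_f) ((hzero 0 x).trans (map_zero _).symm)
      | succ i =>
        obtain ⟨y, rfl⟩ := Ext.covariant_sequence_exact₁ N hS x (hzero _ x) rfl
        have := hvan i (by omega)
        rw [show y = 0 from Subsingleton.elim (α := Ext N (ModuleCat.of R (QuotSMulTop r M)) i) _ _]
        exact Ext.zero_comp ..
    refine ⟨hvan', ⟨?_⟩⟩
    let δ : Ext N (ModuleCat.of R (QuotSMulTop r M)) rs.length →ₗ[R] Ext N M (rs.length + 1) :=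
      hS.extClass.postcompOfLinear R N rfl
    have hδ : Function.Bijective δ := by
      refine ⟨(injective_iff_map_eq_zero _).mpr fun x hx ↦ ?_, fun x ↦
        Ext.covariant_sequence_exact₁ N hS x (hzero _ x) rfl⟩
      obtain ⟨y, rfl⟩ := Ext.covariant_sequence_exact₃ N hS x rfl hx
      have := hvan' rs.length (by omega)
      rw [show y = 0 from Subsingleton.elim (α := Ext N M rs.length) _ _]
      exact Ext.zero_comp ..
    exact (LinearEquiv.ofBijective δ hδ).symm.trans (e.trans
      (Submodule.quotOfListConsSMulTopEquivQuotSMulTopInner M r rs).symm.congrRight)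

/-- Rees: for weakly regular sequences `rs`, `ss` of the same length that annihilate `N`, the
modules `Hom(N, M/(rs)M)` and `Hom(N, M/(ss)M)` are isomorphic. -/
theorem nonempty_hom_quotient_equiv_of_isWeaklyRegular (N M : Type u) [AddCommGroup N]
    [Module R N] [AddCommGroup M] [Module R M] {rs ss : List R} (hlen : rs.length = ss.length)
    (hrs : ∀ r ∈ rs, r ∈ Module.annihilator R N) (hss : ∀ r ∈ ss, r ∈ Module.annihilator R N)
    (h : IsWeaklyRegular M rs) (h' : IsWeaklyRegular M ss) :
    Nonempty ((N →ₗ[R] M ⧸ (Ideal.ofList rs • ⊤ : Submodule R M)) ≃ₗ[R]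
      (N →ₗ[R] M ⧸ (Ideal.ofList ss • ⊤ : Submodule R M))) := by
  obtain ⟨-, ⟨e⟩⟩ := subsingleton_ext_and_ext_equiv_hom_of_isWeaklyRegular
    (ModuleCat.of R N) rs hrs (ModuleCat.of R M) h
  obtain ⟨-, ⟨e'⟩⟩ := subsingleton_ext_and_ext_equiv_hom_of_isWeaklyRegular
    (ModuleCat.of R N) ss hss (ModuleCat.of R M) h'
  rw [hlen] at e
  exact ⟨e.symm.trans e'⟩

end RegularSequence

theorem isWeaklyRegular_ofFn_X (R : Type*) [CommRing R] (n : ℕ) :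
    RingTheory.Sequence.IsWeaklyRegular (MvPolynomial (Fin n) R)
      (List.ofFn (X : Fin n → MvPolynomial (Fin n) R)) := by
  refine ⟨fun i hi ↦ ?_⟩
  rw [List.length_ofFn] at hi
  have hI : Ideal.ofList ((List.ofFn (X : Fin n → MvPolynomial (Fin n) R)).take i)
      = Ideal.span (X '' {j : Fin n | (j : ℕ) < i}) := by
    refine congrArg Ideal.span (Set.ext fun p ↦ ?_)
    change p ∈ List.take i _ ↔ _
    simp only [List.mem_take_iff_getElem, List.getElem_ofFn, List.length_ofFn,
      Set.mem_image]
    constructor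
    · rintro ⟨j, hj, rfl⟩
      exact ⟨⟨j, by omega⟩, by simpa using hj.trans_le (min_le_left _ _), rfl⟩
    · rintro ⟨j, hj, rfl⟩
      exact ⟨j, lt_min hj j.2, rfl⟩
  rw [hI, isSMulRegular_quotient_iff_mem_of_smul_mem]
  intro p hp
  simp only [smul_eq_mul, Ideal.mul_top, List.getElem_ofFn, mem_ideal_span_X_image] at hp ⊢
  intro m hm
  obtain ⟨j, hj, hne⟩ := hp (Finsupp.single ⟨i, hi⟩ 1 + m) (by
    rwa [mem_support_iff, coeff_X_mul, ← mem_support_iff])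
  refine ⟨j, hj, ?_⟩
  have : (⟨i, hi⟩ : Fin n) ≠ j := by
    rintro rfl
    simp at hj
  simpa [Finsupp.single_apply, this] using hne

theorem mem_idealOfVars_iff_constantCoeff {σ R : Type*} [CommRing R] {p : MvPolynomial σ R} :
    p ∈ idealOfVars σ R ↔ constantCoeff p = 0 := by
  rw [idealOfVars, ← Set.image_univ, mem_ideal_span_X_image]
  constructor
  · intro h
    by_contra h0
    obtain ⟨i, -, hi⟩ := h 0 (by rwa [mem_support_iff, ← constantCoeff_eq])
    simp at hi
  · intro h m hm
    have hm0 : m ≠ 0 := by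
      rintro rfl
      exact (mem_support_iff.mp hm) h
    obtain ⟨i, hi⟩ := Finsupp.ne_iff.mp hm0
    exact ⟨i, Set.mem_univ _, hi⟩

theorem Ideal.ofList_ofFn {R : Type*} [CommRing R] {n : ℕ} (a : Fin n → R) :
    Ideal.ofList (List.ofFn a) = Ideal.span (Set.range a) :=
  congrArg Ideal.span (Set.ext fun _ ↦ List.mem_ofFn)

theorem nonempty_hom_quotient_span_equiv {R : Type*} [CommRing R] {n : ℕ} {a b : Fin n → R}
    {J : Ideal R} (ha : ∀ i, a i ∈ J) (hb : ∀ i, b i ∈ J)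
    (h : RingTheory.Sequence.IsWeaklyRegular R (List.ofFn a))
    (h' : RingTheory.Sequence.IsWeaklyRegular R (List.ofFn b)) :
    Nonempty (((R ⧸ J) →ₗ[R] R ⧸ Ideal.span (Set.range a)) ≃ₗ[R]
      ((R ⧸ J) →ₗ[R] R ⧸ Ideal.span (Set.range b))) := by
  have key := nonempty_hom_quotient_equiv_of_isWeaklyRegular (R ⧸ J) R
    (rs := List.ofFn a) (ss := List.ofFn b) (by simp)
    (by simpa [List.mem_ofFn, Ideal.annihilator_quotient] using ha)
    (by simpa [List.mem_ofFn, Ideal.annihilator_quotient] using hb) h h'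
  have hspan (c : Fin n → R) :
      (Ideal.ofList (List.ofFn c) • ⊤ : Submodule R R) = Ideal.span (Set.range c) := by
    rw [smul_eq_mul, Ideal.mul_top, Ideal.ofList_ofFn]
  rwa [hspan, hspan] at key

/-- The socle of the quotient of `F[X₁, …, Xₙ]` by a regular sequence of length `n` contained in
the ideal of the variables is one-dimensional. -/
theorem exists_socle_generator_of_isWeaklyRegular {F : Type*} [Field F] {n : ℕ}
    {a : Fin n → MvPolynomial (Fin n) F} (ha : ∀ i, a i ∈ idealOfVars (Fin n) F)
    (h : RingTheory.Sequence.IsWeaklyRegular (MvPolynomial (Fin n) F) (List.ofFn a)) :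
    ∃ s ∉ Ideal.span (Set.range a), (∀ i, X i * s ∈ Ideal.span (Set.range a)) ∧
      ∀ p, (∀ i, X i * p ∈ Ideal.span (Set.range a)) →
        ∃ c : F, p - C c * s ∈ Ideal.span (Set.range a) := by
  set I := Ideal.span (Set.range a) with hI
  set J := idealOfVars (Fin n) F with hJ
  obtain ⟨e⟩ : Nonempty (((MvPolynomial (Fin n) F ⧸ J) →ₗ[MvPolynomial (Fin n) F]
      MvPolynomial (Fin n) F ⧸ I) ≃ₗ[MvPolynomial (Fin n) F]
      ((MvPolynomial (Fin n) F ⧸ J) →ₗ[MvPolynomial (Fin n) F] MvPolynomial (Fin n) F ⧸ J)) :=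
    nonempty_hom_quotient_span_equiv ha (fun i ↦ Ideal.subset_span (Set.mem_range_self i))
      h (isWeaklyRegular_ofFn_X F n)
  have hom_ext {L : Ideal (MvPolynomial (Fin n) F)}
      {f g : (MvPolynomial (Fin n) F ⧸ J) →ₗ[MvPolynomial (Fin n) F] MvPolynomial (Fin n) F ⧸ L}
      (hfg : f (Submodule.Quotient.mk 1) = g (Submodule.Quotient.mk 1)) : f = g :=
    Submodule.linearMap_qext _ (LinearMap.ext_ring hfg)
  obtain ⟨s, hs⟩ := Submodule.Quotient.mk_surjective _
    (e.symm LinearMap.id (Submodule.Quotient.mk 1))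
  refine ⟨s, fun hsI ↦ ?_, fun i ↦ ?_, fun p hp ↦ ?_⟩
  · rw [(Submodule.Quotient.mk_eq_zero _).mpr hsI] at hs
    have h0 : e.symm LinearMap.id = 0 := hom_ext hs.symm
    have h1 := LinearMap.congr_fun (e.symm.map_eq_zero_iff.mp h0) (Submodule.Quotient.mk 1)
    have h2 : (1 : MvPolynomial (Fin n) F) ∈ J := (Submodule.Quotient.mk_eq_zero _).mp h1
    rw [hJ, mem_idealOfVars_iff_constantCoeff] at h2
    simp at h2
  · rw [← smul_eq_mul, ← Submodule.Quotient.mk_eq_zero, Submodule.Quotient.mk_smul, hs,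
      ← map_smul, ← Submodule.Quotient.mk_smul,
      (Submodule.Quotient.mk_eq_zero _).mpr, map_zero]
    simpa using Ideal.subset_span (Set.mem_range_self i)
  · have hle : J ≤ LinearMap.ker (LinearMap.toSpanSingleton (MvPolynomial (Fin n) F)
        (MvPolynomial (Fin n) F ⧸ I) (Submodule.Quotient.mk p)) := by
      rw [hJ, idealOfVars, Ideal.span_le]
      rintro _ ⟨i, rfl⟩
      exact (Submodule.Quotient.mk_eq_zero _).mpr (hp i)
    let φ : (MvPolynomial (Fin n) F ⧸ J) →ₗ[MvPolynomial (Fin n) F] MvPolynomial (Fin n) F ⧸ I :=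
      Submodule.liftQ J _ hle
    have hφ : φ (Submodule.Quotient.mk 1) = Submodule.Quotient.mk p :=
      one_smul (MvPolynomial (Fin n) F) (Submodule.Quotient.mk p : MvPolynomial (Fin n) F ⧸ I)
    obtain ⟨q, hq⟩ := Submodule.Quotient.mk_surjective _ (e φ (Submodule.Quotient.mk 1))
    have heφ : e φ = C (σ := Fin n) (constantCoeff q) • LinearMap.id := by
      refine hom_ext ?_
      rw [← hq, LinearMap.smul_apply, LinearMap.id_apply, ← Submodule.Quotient.mk_smul,
        Submodule.Quotient.eq, hJ, mem_idealOfVars_iff_constantCoeff]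
      simp
    refine ⟨constantCoeff q, ?_⟩
    rw [← e.eq_symm_apply, map_smul] at heφ
    rw [← smul_eq_mul, ← Submodule.Quotient.eq, Submodule.Quotient.mk_smul, hs, ← hφ, heφ,
      LinearMap.smul_apply]

section Graded

variable {σ F Γ : Type*} [CommRing F] [AddCommGroup Γ] {w : σ → Γ}

theorem weightedHomogeneousComponent_mul_of_isWeightedHomogeneous {u : MvPolynomial σ F} {d : Γ}
    (hu : u.IsWeightedHomogeneous w d) (g : Γ) (p : MvPolynomial σ F) :
    weightedHomogeneousComponent w g (p * u) = weightedHomogeneousComponent w (g - d) p * u := by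
  classical
  induction p using MvPolynomial.induction_on' with
  | monomial e c =>
    have he := isWeightedHomogeneous_monomial w e c rfl
    rw [weightedHomogeneousComponent_of_mem (he.mul hu), weightedHomogeneousComponent_of_mem he]
    simp only [sub_eq_iff_eq_add, ite_mul, zero_mul]
  | add p q hp hq => rw [add_mul, map_add, hp, hq, map_add, add_mul]

theorem weightedHomogeneousComponent_mem_span {ι : Type*} {a : ι → MvPolynomial σ F} {d : ι → Γ}
    (ha : ∀ i, (a i).IsWeightedHomogeneous w (d i)) {p : MvPolynomial σ F}
    (hp : p ∈ Ideal.span (Set.range a)) (g : Γ) :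
    weightedHomogeneousComponent w g p ∈ Ideal.span (Set.range a) := by
  induction hp using Submodule.closure_induction with
  | zero => simp
  | add p q _ _ hp hq => rw [map_add]; exact add_mem hp hq
  | smul_mem r x hx =>
    obtain ⟨i, rfl⟩ := hx
    rw [smul_eq_mul, weightedHomogeneousComponent_mul_of_isWeightedHomogeneous (ha i)]
    exact Ideal.mul_mem_left _ _ (Ideal.subset_span ⟨i, rfl⟩)

variable {I : Ideal (MvPolynomial σ F)}

theorem mem_of_sub_mul_X_mul_mem (hw : ∀ d : σ →₀ ℕ, Finsupp.weight w d = 0 → d = 0)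
    (hI : ∀ p ∈ I, ∀ g, weightedHomogeneousComponent w g p ∈ I) {z b : MvPolynomial σ F} {g : Γ}
    (hz : z.IsWeightedHomogeneous w g) {i : σ} (h : z - b * (X i * z) ∈ I) : z ∈ I := by
  classical
  have hXz := (isWeightedHomogeneous_X F w i).mul hz
  have hb : weightedHomogeneousComponent w (g - (w i + g)) b = 0 := by
    refine weightedHomogeneousComponent_eq_zero' _ _ fun d _ hd ↦ ?_
    have := hw (d + Finsupp.single i 1) (by
      rw [map_add, hd, Finsupp.weight_single, one_smul]; abel)
    simpa using DFunLike.congr_fun this i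
  have := hI _ h g
  rwa [map_sub, hz.weightedHomogeneousComponent_same,
    weightedHomogeneousComponent_mul_of_isWeightedHomogeneous hXz, hb, zero_mul, sub_zero] at this

theorem exists_monomial_mul_mem_socle [IsArtinianRing (MvPolynomial σ F ⧸ I)]
    (hw : ∀ d : σ →₀ ℕ, Finsupp.weight w d = 0 → d = 0)
    (hI : ∀ p ∈ I, ∀ g, weightedHomogeneousComponent w g p ∈ I) {y : MvPolynomial σ F} {g : Γ}
    (hy : y.IsWeightedHomogeneous w g) (hyI : y ∉ I) :
    ∃ d : σ →₀ ℕ, monomial d 1 * y ∉ I ∧ ∀ i, X i * (monomial d 1 * y) ∈ I := by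
  obtain ⟨_, ⟨d, hd, rfl⟩, hmin⟩ := IsArtinian.set_has_minimal
    ((fun d : σ →₀ ℕ ↦ Ideal.span {Ideal.Quotient.mk I (monomial d 1 * y)}) ''
      {d | monomial d 1 * y ∉ I}) ⟨_, 0, by simpa using hyI, rfl⟩
  refine ⟨d, hd, fun i ↦ ?_⟩
  by_contra hi
  have hX : X i * (monomial d (1 : F) * y) = monomial (Finsupp.single i 1 + d) 1 * y := by
    rw [X, ← mul_assoc, monomial_mul, one_mul]
  have hle : Ideal.span {Ideal.Quotient.mk I (X i * (monomial d 1 * y))} ≤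
      Ideal.span {Ideal.Quotient.mk I (monomial d 1 * y)} := by
    rw [Ideal.span_singleton_le_span_singleton]
    exact map_dvd (Ideal.Quotient.mk I) (dvd_mul_left _ _)
  have heq := hle.eq_of_not_lt (hmin _ ⟨_, by rwa [hX] at hi, by rw [hX]⟩)
  obtain ⟨b, hb⟩ := Ideal.mem_span_singleton'.mp (heq.ge (Ideal.mem_span_singleton_self _))
  obtain ⟨b, rfl⟩ := Ideal.Quotient.mk_surjective b
  rw [← map_mul, eq_comm, Ideal.Quotient.eq] at hb
  exact hd (mem_of_sub_mul_X_mul_mem hw hI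
    ((isWeightedHomogeneous_monomial w d 1 rfl).mul hy) hb)

theorem exists_weightedHomogeneousComponent_notMem {p : MvPolynomial σ F} (hp : p ∉ I) :
    ∃ g, weightedHomogeneousComponent w g p ∉ I := by
  by_contra! h
  refine hp ?_
  rw [← finsum_weightedHomogeneousComponent w p]
  exact finsum_induction (· ∈ I) I.zero_mem (fun _ _ ↦ I.add_mem) h

end Graded

theorem constantCoeff_eq_zero_of_isWeightedHomogeneous {σ F Γ : Type*} [Field F] [AddCommGroup Γ]
    {w : σ → Γ} (hw : ∀ d : σ →₀ ℕ, Finsupp.weight w d = 0 → d = 0) {p : MvPolynomial σ F} {g : Γ}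
    (hp : p.IsWeightedHomogeneous w g) (hu : ¬ IsUnit p) : constantCoeff p = 0 := by
  by_contra h0
  have hg : g = 0 := by simpa using (hp h0).symm
  have hC : p = C (constantCoeff p) := by
    classical
    ext m
    rw [coeff_C]
    split_ifs with hm
    · rw [← hm, constantCoeff_eq]
    · by_contra hne
      exact hm (hw m ((hp hne).trans hg)).symm
  rw [hC] at hu
  exact hu ((isUnit_iff_ne_zero.mpr h0).map C)

theorem isArtinianRing_quotient_of_isWeaklyRegular {F : Type*} [Field F] {n : ℕ}
    {a : Fin n → MvPolynomial (Fin n) F}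
    (h : RingTheory.Sequence.IsWeaklyRegular (MvPolynomial (Fin n) F) (List.ofFn a)) :
    IsArtinianRing (MvPolynomial (Fin n) F ⧸ Ideal.span (Set.range a)) := by
  have hdim := ringKrullDim_quotient_add_length_le_of_isWeaklyRegular _ h
  rw [MvPolynomial.ringKrullDim_of_isNoetherianRing, ringKrullDim_eq_zero_of_field,
    Ideal.ofList_ofFn, List.length_ofFn, Nat.card_eq_fintype_card, Fintype.card_fin] at hdim
  rw [isArtinianRing_iff_krullDimLE_zero, Ring.krullDimLE_iff]
  exact ENat.WithBot.add_le_add_natCast_right_iff.mp hdim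

/-- A generator of a one-dimensional socle of a graded quotient can be chosen homogeneous. -/
theorem exists_isWeightedHomogeneous_socle_generator {σ F Γ : Type*} [Field F] [AddCommGroup Γ]
    {w : σ → Γ} {I : Ideal (MvPolynomial σ F)}
    (hI : ∀ p ∈ I, ∀ g, weightedHomogeneousComponent w g p ∈ I) {s : MvPolynomial σ F}
    (hs : s ∉ I) (hX : ∀ i, X i * s ∈ I)
    (hgen : ∀ p, (∀ i, X i * p ∈ I) → ∃ c : F, p - C c * s ∈ I) :
    ∃ t ω, t.IsWeightedHomogeneous w ω ∧ t ∉ I ∧ (∀ i, X i * t ∈ I) ∧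
      ∀ p, (∀ i, X i * p ∈ I) → ∃ c : F, p - C c * t ∈ I := by
  obtain ⟨ω, hω⟩ := exists_weightedHomogeneousComponent_notMem (w := w) hs
  set t := weightedHomogeneousComponent w ω s with ht
  have hXt (i : σ) : X i * t ∈ I := by
    have := hI _ (hX i) (ω + w i)
    rwa [mul_comm, weightedHomogeneousComponent_mul_of_isWeightedHomogeneous
      (isWeightedHomogeneous_X F w i), add_sub_cancel_right, mul_comm] at this
  refine ⟨t, ω, weightedHomogeneousComponent_isWeightedHomogeneous _ _, hω, hXt, fun p hp ↦ ?_⟩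
  obtain ⟨c, hc⟩ := hgen t hXt
  obtain ⟨b, hb⟩ := hgen p hp
  have hc0 : c ≠ 0 := by
    rintro rfl
    simp [hω] at hc
  refine ⟨b / c, ?_⟩
  have hbc : C (σ := σ) (b / c) * C c = C b := by rw [← C_mul, div_mul_cancel₀ b hc0]
  have := I.sub_mem hb (I.mul_mem_left (C (b / c)) hc)
  rwa [mul_sub, ← mul_assoc, hbc, sub_sub_sub_cancel_right] at this

theorem mk_mem_socle {F : Type*} [Field F] {n : ℕ} {I : Ideal (MvPolynomial (Fin n) F)}
    {p : MvPolynomial (Fin n) F} :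
    Ideal.Quotient.mk I p ∈ socle I ↔ ∀ i, X i * p ∈ I := by
  rw [socle, varIdeal, Submodule.mem_colon]
  constructor
  · intro h i
    rw [← Ideal.Quotient.eq_zero_iff_mem, mul_comm, map_mul]
    exact h _ (Ideal.subset_span ⟨i, rfl⟩)
  · intro h q hq
    induction hq using Submodule.span_induction with
    | mem q hq =>
      obtain ⟨i, rfl⟩ := hq
      rw [smul_eq_mul, ← map_mul, mul_comm, Submodule.mem_bot, Ideal.Quotient.eq_zero_iff_mem]
      exact h i
    | zero => simp
    | add x y _ _ hx hy => rw [smul_add]; exact add_mem hx hy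
    | smul r x _ hx => rw [smul_comm]; exact Submodule.smul_mem _ r hx

theorem complete_intersection_is_cox_gorenstein
    (w : Fin n → G) (hpos : ∀ i, (0 : G) ≤ w i)
    (hw0 : ∀ d : Fin n →₀ ℕ, Finsupp.weight w d = 0 → d = 0)
    (α : Fin n → MvPolynomial (Fin n) K) (d : Fin n → G)
    (hα : ∀ i, (α i).IsWeightedHomogeneous w (d i))
    (hreg : RingTheory.Sequence.IsRegular (MvPolynomial (Fin n) K) (List.ofFn α)) :
    IsArtinianRing (MvPolynomial (Fin n) K ⧸ Ideal.span (Set.range α)) ∧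
      ∃ ω : G,
        Submodule.restrictScalars K (socle (Ideal.span (Set.range α)))
          = qpiece w (Ideal.span (Set.range α)) ω ∧
        Module.finrank K (qpiece w (Ideal.span (Set.range α)) ω) = 1 := by
  set I := Ideal.span (Set.range α)
  have hI : ∀ p ∈ I, ∀ g, weightedHomogeneousComponent w g p ∈ I :=
    fun p hp g ↦ weightedHomogeneousComponent_mem_span hα hp g
  have htop : I ≠ ⊤ := by
    have := hreg.top_ne_smul
    rw [smul_eq_mul, Ideal.mul_top, Ideal.ofList_ofFn] at this
    exact this.symm
  have hvars (i : Fin n) : α i ∈ idealOfVars (Fin n) K :=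
    mem_idealOfVars_iff_constantCoeff.mpr <|
      constantCoeff_eq_zero_of_isWeightedHomogeneous hw0 (hα i) fun hu ↦
        htop (Ideal.eq_top_of_isUnit_mem _ (Ideal.subset_span ⟨i, rfl⟩) hu)
  have hart : IsArtinianRing (MvPolynomial (Fin n) K ⧸ I) :=
    isArtinianRing_quotient_of_isWeaklyRegular hreg.toIsWeaklyRegular
  obtain ⟨s₀, hs₀, hXs₀, hgen₀⟩ : ∃ s ∉ I, (∀ i, X i * s ∈ I) ∧
      ∀ p, (∀ i, X i * p ∈ I) → ∃ c : K, p - C c * s ∈ I :=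
    exists_socle_generator_of_isWeaklyRegular hvars hreg.toIsWeaklyRegular
  obtain ⟨s, ω, hsω, hs, hXs, hgen⟩ :=
    exists_isWeightedHomogeneous_socle_generator hI hs₀ hXs₀ hgen₀
  have hsocle : Submodule.restrictScalars K (socle I) = K ∙ Ideal.Quotient.mk I s := by
    ext x
    obtain ⟨p, rfl⟩ := Ideal.Quotient.mk_surjective x
    rw [Submodule.restrictScalars_mem, mk_mem_socle, Submodule.mem_span_singleton]
    constructor
    · intro hp
      obtain ⟨c, hc⟩ := hgen p hp
      refine ⟨c, ?_⟩
      rw [← Ideal.Quotient.mk_eq_mk_iff_sub_mem] at hc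
      rw [hc, ← smul_eq_C_mul]
      rfl
    · rintro ⟨c, hc⟩ i
      have hc' : p - c • s ∈ I := (Ideal.Quotient.mk_eq_mk_iff_sub_mem _ _).mp hc.symm
      have := I.add_mem (I.mul_mem_left (X i) hc') (I.mul_mem_left (C c) (hXs i))
      rwa [smul_eq_C_mul, show X i * (p - C c * s) + C c * (X i * s) = X i * p by ring] at this
  have hpiece : Submodule.restrictScalars K (socle I) = qpiece w I ω := by
    apply le_antisymm
    · rw [hsocle, Submodule.span_singleton_le_iff_mem]
      exact ⟨s, hsω, rfl⟩
    · rintro _ ⟨y, hy, rfl⟩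
      have hy : y.IsWeightedHomogeneous w ω := hy
      change Ideal.Quotient.mk I y ∈ socle I
      by_cases hyI : y ∈ I
      · rw [Ideal.Quotient.eq_zero_iff_mem.mpr hyI]
        exact zero_mem _
      obtain ⟨e, heI, heX⟩ := exists_monomial_mul_mem_socle hw0 hI hy hyI
      obtain ⟨c, hc⟩ := hgen _ heX
      have he : e = 0 := by
        by_contra he
        have hcomp := hI _ hc (Finsupp.weight w e + ω)
        rw [map_sub, ← smul_eq_C_mul, map_smul,
          ((isWeightedHomogeneous_monomial w e 1 rfl).mul hy).weightedHomogeneousComponent_same,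
          hsω.weightedHomogeneousComponent_ne _ (by simpa using fun h ↦ he (hw0 e h)),
          smul_zero, sub_zero] at hcomp
        exact heI hcomp
      rw [mk_mem_socle]
      simpa [he] using heX
  refine ⟨hart, ω, hpiece, ?_⟩
  rw [← hpiece, hsocle]
  exact finrank_span_singleton (mt Ideal.Quotient.eq_zero_iff_mem.mp hs)

end
end
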